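/- Let (M, d) be a metric space in which every closed and bounded subset is compact (i.e., M is a proper metric space), and let x, y ∈ M be points that are connected by some continuous path of finite length. Then there exists a continuous path from x to y of minimal length: a continuous path p : [0, 1] → M with p(0) = x, p(1) = y, of finite length, whose length is less than or equal to the length of every continuous finite-length path in M from x to y. -/

import Mathlib

/-- The set of approximations `Λ_P = ∑ d(p(t_j), p(t_{j-1}))` to the length of
the path `p` on `[a, b]`, over all partitions `a = t₀ < t₁ < ⋯ < tₙ = b`. -/
def pathSums {M : Type*} [MetricSpace M] (p : ℝ → M) (a b : ℝ) : Set ℝ :=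
  {L | ∃ (n : ℕ) (t : ℕ → ℝ), t 0 = a ∧ t n = b ∧ (∀ i < n, t i < t (i + 1)) ∧
        L = ∑ i ∈ Finset.range n, dist (p (t i)) (p (t (i + 1)))}

/-- A path has finite length if its approximations `Λ_P` are bounded above. -/
def HasFiniteLength {M : Type*} [MetricSpace M] (p : ℝ → M) (a b : ℝ) : Prop :=
  BddAbove (pathSums p a b)

/-- The length of a path: the supremum of the approximations `Λ_P`. -/
noncomputable def pathLength {M : Type*} [MetricSpace M] (p : ℝ → M) (a b : ℝ) : ℝ :=
  sSup (pathSums p a b)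

open Set Filter Topology

section PathSums

variable {M : Type*} [MetricSpace M] {p : ℝ → M} {a b c d : ℝ}

/-- Appending a point to a partition adds the corresponding distance. -/
theorem add_dist_mem_pathSums {S : ℝ} (hS : S ∈ pathSums p a c) (hcd : c ≤ d) :
    S + dist (p c) (p d) ∈ pathSums p a d := by
  rcases hcd.eq_or_lt with rfl | hlt
  · simpa using hS
  obtain ⟨n, t, h0, hn, ht, rfl⟩ := hS
  refine ⟨n + 1, fun i => if i ≤ n then t i else d, by simpa using h0, by simp, ?_, ?_⟩
  · intro i hi
    rcases Nat.lt_succ_iff_lt_or_eq.1 hi with h | rfl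
    · simpa [h.le, h] using ht i h
    · simpa [hn] using hlt
  · rw [Finset.sum_range_succ]
    congr 1
    · refine Finset.sum_congr rfl fun i hi => ?_
      have h := Finset.mem_range.1 hi
      simp [h.le, Nat.succ_le_of_lt h]
    · simp [hn]

theorem zero_mem_pathSums_self : (0 : ℝ) ∈ pathSums p a a :=
  ⟨0, fun _ => a, rfl, rfl, by simp, by simp⟩

theorem pathLength_nonneg : 0 ≤ pathLength p a b := by
  refine Real.sSup_nonneg ?_
  rintro _ ⟨n, t, -, -, -, rfl⟩
  exact Finset.sum_nonneg fun _ _ => dist_nonneg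

/-- Every sum along a monotone sequence is dominated by the sum of a partition. -/
theorem exists_pathSums_ge {u : ℕ → ℝ} (hu : Monotone u) (ha : a ≤ u 0) (n : ℕ) :
    ∃ S ∈ pathSums p a (u n), ∑ i ∈ Finset.range n, dist (p (u (i + 1))) (p (u i)) ≤ S := by
  induction n with
  | zero =>
    exact ⟨_, add_dist_mem_pathSums zero_mem_pathSums_self ha, by simp⟩
  | succ n ih =>
    obtain ⟨S, hS, hle⟩ := ih
    refine ⟨_, add_dist_mem_pathSums hS (hu n.le_succ), ?_⟩
    rw [Finset.sum_range_succ, dist_comm (p (u (n + 1)))]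
    gcongr

theorem eVariationOn_le_pathLength (hp : HasFiniteLength p a b) :
    eVariationOn p (Icc a b) ≤ ENNReal.ofReal (pathLength p a b) := by
  refine iSup_le ?_
  rintro ⟨n, u, hu, hmem⟩
  obtain ⟨S, hS, hle⟩ := exists_pathSums_ge (p := p) hu (hmem 0).1 n
  have hS' := le_csSup hp (add_dist_mem_pathSums hS (hmem n).2)
  simp only [edist_dist]
  rw [← ENNReal.ofReal_sum_of_nonneg fun _ _ => dist_nonneg]
  refine ENNReal.ofReal_le_ofReal (hle.trans (le_trans ?_ hS'))
  exact le_add_of_nonneg_right dist_nonneg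

/-- The partition sums of a `C`-Lipschitz path are at most `C * (b - a)`. -/
theorem pathSums_le_of_dist_le {C : ℝ}
    (h : ∀ s ∈ Icc a b, ∀ t ∈ Icc a b, dist (p s) (p t) ≤ C * |s - t|) {S : ℝ}
    (hS : S ∈ pathSums p a b) : S ≤ C * (b - a) := by
  obtain ⟨n, t, h0, hn, ht, rfl⟩ := hS
  have hmono : MonotoneOn t (Iic n) := by
    refine monotoneOn_of_le_add_one ordConnected_Iic fun i _ _ hi => (ht i ?_).le
    exact Nat.lt_of_succ_le hi
  have hmem : ∀ i ≤ n, t i ∈ Icc a b := fun i hi =>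
    ⟨h0 ▸ hmono (Nat.zero_le n) hi (Nat.zero_le i), hn ▸ hmono hi (le_refl n) hi⟩
  calc ∑ i ∈ Finset.range n, dist (p (t i)) (p (t (i + 1)))
      ≤ ∑ i ∈ Finset.range n, C * (t (i + 1) - t i) := by
        refine Finset.sum_le_sum fun i hi => ?_
        have hi := Finset.mem_range.1 hi
        have := h _ (hmem i hi.le) _ (hmem (i + 1) hi)
        rwa [abs_sub_comm, abs_of_pos (sub_pos.2 (ht i hi))] at this
    _ = C * (b - a) := by
        rw [← Finset.mul_sum, Finset.sum_range_sub, h0, hn]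

end PathSums

section Reparametrization

variable {M : Type*} [MetricSpace M] {p : ℝ → M} {s : Set ℝ} {a b : ℝ}

theorem continuousOn_variationOnFromTo (hp : LocallyBoundedVariationOn p s)
    (hc : ContinuousOn p s) (ha : a ∈ s) : ContinuousOn (variationOnFromTo p s a) s := by
  intro t ht
  have hl : ContinuousWithinAt (variationOnFromTo p s a) (s ∩ Iio t) t := by
    simpa using! variationOnFromTo.tendsto_left ha ht hp ((hc t ht).mono inter_subset_left)
  have hr : ContinuousWithinAt (variationOnFromTo p s a) (s ∩ Ioi t) t := by
    simpa using! variationOnFromTo.tendsto_right ha ht hp ((hc t ht).mono inter_subset_left)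
  refine ((hl.union hr).union (continuousWithinAt_singleton (x := t))).mono fun r hr => ?_
  rcases lt_trichotomy r t with h | h | h
  · exact Or.inl (Or.inl ⟨hr, h⟩)
  · exact Or.inr h
  · exact Or.inl (Or.inr ⟨hr, h⟩)

theorem dist_le_abs_variationOnFromTo_sub (hp : LocallyBoundedVariationOn p s) (ha : a ∈ s)
    {t u : ℝ} (ht : t ∈ s) (hu : u ∈ s) :
    dist (p t) (p u) ≤ |variationOnFromTo p s a t - variationOnFromTo p s a u| := by
  wlog htu : t ≤ u generalizing t u
  · rw [dist_comm, abs_sub_comm]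
    exact this hu ht (le_of_not_ge htu)
  rw [abs_sub_comm, variationOnFromTo.sub_right hp ha hu ht, variationOnFromTo.eq_of_le _ _ htu,
    abs_of_nonneg ENNReal.toReal_nonneg]
  exact (hp t u ht hu).dist_le ⟨ht, le_rfl, htu⟩ ⟨hu, htu, le_rfl⟩

/-- A continuous path of finite length can be reparametrized on `[0, 1]` proportionally to arc
length, hence with Lipschitz constant its length. -/
theorem exists_lipschitz_reparametrization (hab : a ≤ b) (hc : ContinuousOn p (Icc a b))
    (hp : HasFiniteLength p a b) :
    ∃ q : ℝ → M, q 0 = p a ∧ q 1 = p b ∧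
      ∀ s ∈ Icc (0 : ℝ) 1, ∀ t ∈ Icc (0 : ℝ) 1,
        dist (q s) (q t) ≤ pathLength p a b * |s - t| := by
  have hvar := eVariationOn_le_pathLength hp
  have hbv : LocallyBoundedVariationOn p (Icc a b) :=
    BoundedVariationOn.locallyBoundedVariationOn (ne_top_of_le_ne_top ENNReal.ofReal_ne_top hvar)
  have ha : a ∈ Icc a b := left_mem_Icc.2 hab
  have hb : b ∈ Icc a b := right_mem_Icc.2 hab
  set v := variationOnFromTo p (Icc a b) a with hv
  have hva : v a = 0 := variationOnFromTo.self _ _ _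
  have hvb : v b ≤ pathLength p a b := by
    rw [hv, variationOnFromTo.eq_of_le _ _ hab, inter_self]
    exact ENNReal.toReal_le_of_le_ofReal pathLength_nonneg hvar
  have hvb0 : 0 ≤ v b := variationOnFromTo.nonneg_of_le _ _ hab
  have hex : ∀ s : ℝ, ∃ t, s ∈ Icc (0 : ℝ) 1 → t ∈ Icc a b ∧ v t = v b * s := by
    intro s
    by_cases hs : s ∈ Icc (0 : ℝ) 1
    · have hmem : v b * s ∈ Icc (v a) (v b) :=
        ⟨by rw [hva]; exact mul_nonneg hvb0 hs.1, mul_le_of_le_one_right hvb0 hs.2⟩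
      obtain ⟨t, ht, hts⟩ :=
        intermediate_value_Icc hab (continuousOn_variationOnFromTo hbv hc ha) hmem
      exact ⟨t, fun _ => ⟨ht, hts⟩⟩
    · exact ⟨0, fun h => absurd h hs⟩
  choose τ hτ using hex
  have heq : ∀ {t u : ℝ}, t ∈ Icc a b → u ∈ Icc a b → v t = v u → p t = p u := by
    intro t u ht hu h
    have := dist_le_abs_variationOnFromTo_sub hbv ha ht hu
    rw [← hv, h, sub_self, abs_zero] at this
    exact dist_le_zero.1 this
  refine ⟨p ∘ τ, ?_, ?_, fun s hs t ht => ?_⟩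
  · obtain ⟨hm, he⟩ := hτ 0 (by simp)
    exact heq hm ha (by rw [he, hva, mul_zero])
  · obtain ⟨hm, he⟩ := hτ 1 (by simp)
    exact heq hm hb (by rw [he, mul_one])
  · obtain ⟨hms, hes⟩ := hτ s hs
    obtain ⟨hmt, het⟩ := hτ t ht
    refine (dist_le_abs_variationOnFromTo_sub hbv ha hms hmt).trans ?_
    rw [← hv, hes, het, ← mul_sub, abs_mul, abs_of_nonneg hvb0]
    gcongr

end Reparametrization

/-- If the constants `C n` converge to `L`, then `C n`-Lipschitz paths between fixed endpoints in
a proper space subconverge to an `L`-Lipschitz path. -/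
theorem exists_lipschitz_limit_path {M : Type*} [MetricSpace M] [ProperSpace M] {x y : M}
    {L : ℝ} {C : ℕ → ℝ} (hC : Tendsto C atTop (𝓝 L)) {q : ℕ → ℝ → M}
    (h0 : ∀ n, q n 0 = x) (h1 : ∀ n, q n 1 = y)
    (hq : ∀ n, ∀ s ∈ Icc (0 : ℝ) 1, ∀ t ∈ Icc (0 : ℝ) 1, dist (q n s) (q n t) ≤ C n * |s - t|) :
    ∃ r : ℝ → M, r 0 = x ∧ r 1 = y ∧
      ∀ s ∈ Icc (0 : ℝ) 1, ∀ t ∈ Icc (0 : ℝ) 1, dist (r s) (r t) ≤ L * |s - t| := by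
  obtain ⟨B, hB⟩ := hC.bddAbove_range
  have hCu : Tendsto C (hyperfilter ℕ) (𝓝 L) :=
    hC.mono_left (Nat.cofinite_eq_atTop ▸ hyperfilter_le_cofinite)
  have hex : ∀ s : ℝ, ∃ z, s ∈ Icc (0 : ℝ) 1 →
      Tendsto (fun n => q n s) (hyperfilter ℕ) (𝓝 z) := by
    intro s
    by_cases hs : s ∈ Icc (0 : ℝ) 1
    · have hball : ∀ n, q n s ∈ Metric.closedBall x (B * |s - 0|) := fun n => by
        rw [Metric.mem_closedBall, ← h0 n]
        refine (hq n s hs 0 (by simp)).trans ?_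
        gcongr
        exact hB (mem_range_self n)
      obtain ⟨z, -, hz⟩ := (isCompact_closedBall x (B * |s - 0|)).ultrafilter_le_nhds
        ((hyperfilter ℕ).map fun n => q n s)
        (le_principal_iff.2 (Ultrafilter.mem_map.2 (univ_mem' hball)))
      exact ⟨z, fun _ => hz⟩
    · exact ⟨x, fun h => absurd h hs⟩
  choose r hr using hex
  refine ⟨r, ?_, ?_, fun s hs t ht => ?_⟩
  · refine tendsto_nhds_unique (hr 0 (by simp)) ?_
    simp [h0]
  · refine tendsto_nhds_unique (hr 1 (by simp)) ?_
    simp [h1]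
  · exact le_of_tendsto_of_tendsto' ((hr s hs).dist (hr t ht)) (hCu.mul_const _)
      fun n => hq n s hs t ht

/-- In a metric space where closed bounded sets are compact, any two points
joined by a continuous path of finite length are joined by a continuous path of
minimal length. -/
theorem exists_path_of_minimal_length {M : Type*} [MetricSpace M]
    (hproper : ∀ s : Set M, IsClosed s → Bornology.IsBounded s → IsCompact s)
    (x y : M)
    (hconn : ∃ (a b : ℝ) (p : ℝ → M), a ≤ b ∧ ContinuousOn p (Set.Icc a b) ∧
      p a = x ∧ p b = y ∧ HasFiniteLength p a b) :
    ∃ q : ℝ → M, ContinuousOn q (Set.Icc 0 1) ∧ q 0 = x ∧ q 1 = y ∧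
      HasFiniteLength q 0 1 ∧
      ∀ (a b : ℝ) (p : ℝ → M), a ≤ b → ContinuousOn p (Set.Icc a b) →
        p a = x → p b = y → HasFiniteLength p a b →
          pathLength q 0 1 ≤ pathLength p a b := by
  have : ProperSpace M :=
    ⟨fun _ _ => hproper _ Metric.isClosed_closedBall Metric.isBounded_closedBall⟩
  let lengths : Set ℝ := {l | ∃ (a b : ℝ) (p : ℝ → M), a ≤ b ∧ ContinuousOn p (Icc a b) ∧
      p a = x ∧ p b = y ∧ HasFiniteLength p a b ∧ pathLength p a b = l}
  have hne : lengths.Nonempty := by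
    obtain ⟨a, b, p, hab, hc, ha, hb, hp⟩ := hconn
    exact ⟨_, a, b, p, hab, hc, ha, hb, hp, rfl⟩
  have hbdd : BddBelow lengths := by
    refine ⟨0, ?_⟩
    rintro _ ⟨a, b, p, -, -, -, -, -, rfl⟩
    exact pathLength_nonneg
  obtain ⟨C, -, hC, hmem⟩ := exists_seq_tendsto_sInf hne hbdd
  have hex : ∀ n, ∃ q : ℝ → M, q 0 = x ∧ q 1 = y ∧
      ∀ s ∈ Icc (0 : ℝ) 1, ∀ t ∈ Icc (0 : ℝ) 1, dist (q s) (q t) ≤ C n * |s - t| := by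
    intro n
    obtain ⟨a, b, p, hab, hc, rfl, rfl, hp, hl⟩ := hmem n
    exact hl ▸ exists_lipschitz_reparametrization hab hc hp
  choose q h0 h1 hq using hex
  obtain ⟨r, hr0, hr1, hr⟩ := exists_lipschitz_limit_path hC h0 h1 hq
  have hle : ∀ S ∈ pathSums r 0 1, S ≤ sInf lengths := fun S hS => by
    simpa using pathSums_le_of_dist_le hr hS
  refine ⟨r, ?_, hr0, hr1, ⟨_, hle⟩, fun a b p hab hc ha hb hp => ?_⟩
  · exact (LipschitzOnWith.of_dist_le' fun s hs t ht => hr s hs t ht).continuousOn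
  · refine (csSup_le ?_ hle).trans (csInf_le hbdd ⟨a, b, p, hab, hc, ha, hb, hp, rfl⟩)
    exact ⟨_, add_dist_mem_pathSums zero_mem_pathSums_self zero_le_one⟩
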